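/- arXiv:1312.6631 — 2 statements merged into one kernel-verified Lean document; each statement's English description precedes it below -/
import Mathlib

section
/- Let M be an n×n real symmetric positive definite tridiagonal matrix with smallest eigenvalue λ_min and largest eigenvalue λ_max, λ_min < λ_max, and let S = M ⊗ I_n + I_n ⊗ M. For k, t ∈ {1, …, n²} set j = ⌊(t−1)/n⌋ + 1, i = t − n⌊(t−1)/n⌋, m = ⌊(k−1)/n⌋ + 1, ℓ = k − n⌊(k−1)/n⌋, and let 𝔫₁ = |ℓ − i| + |m − j| − 1. If exactly one of the equalities ℓ = i, m = j holds and 𝔫₁ > 0, then |(S⁻¹)_{k,t}| ≤ (1/(2√2)) · ((λ_max − λ_min)^{𝔫₁+1} / (λ_max² + λ_min²)^{𝔫₁/2}) · (√(λ_max² + λ_min²) / (λ_max λ_min²)) · (1/√𝔫₁) · √(2𝔫₁/(𝔫₁ + 2)). -/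
open MeasureTheory Real Matrix

/-- The Kronecker sum `S = M ⊗ Iₙ + Iₙ ⊗ M`, written entrywise with 0-based
indices: for `k, t ∈ Fin (n*n)`, the row grid index is `k % n` and the column
grid index is `k / n` (vec convention stacking columns). -/
noncomputable def kronSum (n : ℕ) (M : Matrix (Fin n) (Fin n) ℝ) :
    Matrix (Fin (n * n)) (Fin (n * n)) ℝ := fun k t =>
  have hn : 0 < n := by
    rcases Nat.eq_zero_or_pos n with h | h
    · subst h; exact absurd k.2 (by simp)
    · exact h
  (if (k : ℕ) / n = (t : ℕ) / n then
      M ⟨(k : ℕ) % n, Nat.mod_lt _ hn⟩ ⟨(t : ℕ) % n, Nat.mod_lt _ hn⟩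
    else 0) +
  (if (k : ℕ) % n = (t : ℕ) % n then
      M ⟨(k : ℕ) / n, Nat.div_lt_of_lt_mul k.2⟩ ⟨(t : ℕ) / n, Nat.div_lt_of_lt_mul t.2⟩
    else 0)

/-- Powers of a matrix supported on pairs at distance at most one have support within
the corresponding distance. -/
theorem Matrix.pow_apply_eq_zero_of_lt_dist {α R : Type*} [Fintype α] [DecidableEq α]
    [CommRing R] (δ : α → α → ℕ) (h0 : ∀ x, δ x x = 0)
    (htr : ∀ x y z, δ x z ≤ δ x y + δ y z) (A : Matrix α α R)
    (hA : ∀ x y, 1 < δ x y → A x y = 0) (r : ℕ) :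
    ∀ x y, r < δ x y → (A ^ r) x y = 0 := by
  induction r with
  | zero =>
    intro x y h
    rw [pow_zero, Matrix.one_apply_ne]
    rintro rfl
    simp [h0] at h
  | succ r ih =>
    intro x y h
    rw [pow_succ, Matrix.mul_apply]
    refine Finset.sum_eq_zero fun z _ => ?_
    rcases lt_or_ge r (δ x z) with hz | hz
    · rw [ih x z hz, zero_mul]
    · rw [hA z y (by have := htr x z y; omega), mul_zero]

/-- The entries of an orthogonally diagonalized matrix are bounded by its largest eigenvalue
in absolute value. -/
theorem Matrix.abs_orthogonal_conj_diagonal_apply_le {α : Type*} [Fintype α] [DecidableEq α]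
    (V : Matrix α α ℝ) (hV : V * Vᵀ = 1) (f : α → ℝ) (r : ℝ) (hf : ∀ p, |f p| ≤ r) (x y : α) :
    |(V * diagonal f * Vᵀ) x y| ≤ r := by
  have hnorm : ∀ x, ∑ p, V x p ^ 2 = 1 := fun x => by
    have := congrFun (congrFun hV x) x
    simpa [Matrix.mul_apply, sq] using this
  have hr : 0 ≤ r := (abs_nonneg _).trans (hf x)
  rw [Matrix.mul_apply]
  calc |∑ p, (V * diagonal f) x p * Vᵀ p y|
      ≤ ∑ p, |(V * diagonal f) x p * Vᵀ p y| := Finset.abs_sum_le_sum_abs _ _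
    _ ≤ ∑ p, r * ((V x p ^ 2 + V y p ^ 2) / 2) := by
        refine Finset.sum_le_sum fun p _ => ?_
        rw [Matrix.mul_diagonal, Matrix.transpose_apply, abs_mul, abs_mul]
        have h2 : |V x p| * |V y p| ≤ (V x p ^ 2 + V y p ^ 2) / 2 := by
          nlinarith [sq_nonneg (|V x p| - |V y p|), sq_abs (V x p), sq_abs (V y p)]
        calc |V x p| * |f p| * |V y p| = |f p| * (|V x p| * |V y p|) := by ring
          _ ≤ r * ((V x p ^ 2 + V y p ^ 2) / 2) :=
            mul_le_mul (hf p) h2 (by positivity) hr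
    _ = r := by
        rw [← Finset.mul_sum, ← Finset.sum_div, Finset.sum_add_distrib, hnorm, hnorm]
        ring

/-- Exponential off-diagonal decay of the inverse of an orthogonally diagonalized matrix with
spectrum in `[lo, hi]` whose entries vanish at distance greater than one. -/
theorem Matrix.abs_inv_apply_le_of_dist {α : Type*} [Fintype α] [DecidableEq α]
    (δ : α → α → ℕ) (h0 : ∀ x, δ x x = 0) (htr : ∀ x y z, δ x z ≤ δ x y + δ y z)
    (T V : Matrix α α ℝ) (hV : V * Vᵀ = 1) (μ : α → ℝ) (hT : T = V * diagonal μ * Vᵀ)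
    (hband : ∀ x y, 1 < δ x y → T x y = 0) (lo hi : ℝ) (hlo : 0 < lo)
    (hμ : ∀ p, lo ≤ μ p ∧ μ p ≤ hi) (x y : α) :
    |T⁻¹ x y| ≤ ((hi - lo) / (hi + lo)) ^ δ x y / lo := by
  have hhi : lo ≤ hi := (hμ x).1.trans (hμ x).2
  have hV' : Vᵀ * V = 1 := mul_eq_one_comm.mp hV
  have hmul : ∀ f g : α → ℝ, (V * diagonal f * Vᵀ) * (V * diagonal g * Vᵀ) =
      V * diagonal (fun p => f p * g p) * Vᵀ := fun f g => by
    rw [← Matrix.diagonal_mul_diagonal]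
    calc _ = V * diagonal f * (Vᵀ * V) * diagonal g * Vᵀ := by simp only [Matrix.mul_assoc]
      _ = _ := by rw [hV', Matrix.mul_one]; simp only [Matrix.mul_assoc]
  have hone : V * diagonal (fun _ => (1 : ℝ)) * Vᵀ = 1 := by
    rw [Matrix.diagonal_one, Matrix.mul_one, hV]
  have hμ0 : ∀ p, μ p ≠ 0 := fun p => (hlo.trans_le (hμ p).1).ne'
  have hTinv : T⁻¹ = V * diagonal (fun p => (μ p)⁻¹) * Vᵀ := by
    refine Matrix.inv_eq_right_inv ?_
    rw [hT, hmul, ← hone]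
    simp [hμ0]
  set c := (hi + lo) / 2 with hc
  set A : Matrix α α ℝ := 1 - c⁻¹ • T with hAdef
  have hA : A = V * diagonal (fun p => 1 - c⁻¹ * μ p) * Vᵀ := by
    have : diagonal (fun p => 1 - c⁻¹ * μ p) = 1 - c⁻¹ • diagonal μ := by
      rw [← Matrix.diagonal_one, ← Matrix.diagonal_smul, Matrix.diagonal_sub]
      rfl
    rw [this, hAdef, hT, Matrix.mul_sub, Matrix.sub_mul, Matrix.mul_one, hV,
      Matrix.mul_smul, Matrix.smul_mul]
  have hApow : ∀ r : ℕ, A ^ r = V * diagonal (fun p => (1 - c⁻¹ * μ p) ^ r) * Vᵀ := by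
    intro r
    induction r with
    | zero => simp only [pow_zero]; exact hone.symm
    | succ r ih => rw [pow_succ, ih, hA, hmul]; simp only [pow_succ]
  have hAband : ∀ x y, 1 < δ x y → A x y = 0 := fun x y h => by
    have hne : x ≠ y := by rintro rfl; simp [h0] at h
    simp [hAdef, Matrix.one_apply_ne hne, hband x y h]
  have hTT : T * T⁻¹ = 1 := by
    rw [hTinv, hT, hmul, ← hone]
    simp [hμ0]
  have hexp : T⁻¹ = c⁻¹ • ∑ r ∈ Finset.range (δ x y), A ^ r + A ^ δ x y * T⁻¹ := by
    have hg := geom_sum_mul_neg A (δ x y)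
    have h1A : 1 - A = c⁻¹ • T := by rw [hAdef]; abel
    rw [h1A] at hg
    have := congrArg (· * T⁻¹) hg
    simp only [Matrix.mul_smul, Matrix.smul_mul, Matrix.mul_assoc, hTT, Matrix.mul_one,
      Matrix.sub_mul, Matrix.one_mul] at this
    rw [this]; abel
  have hentry : T⁻¹ x y = (A ^ δ x y * T⁻¹) x y := by
    conv_lhs => rw [hexp]
    rw [Matrix.add_apply, Matrix.smul_apply, Matrix.sum_apply, Finset.sum_eq_zero, smul_zero,
      zero_add]
    intro r hr
    exact Matrix.pow_apply_eq_zero_of_lt_dist δ h0 htr A hAband r x y (Finset.mem_range.mp hr)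
  rw [hentry, hApow, hTinv, hmul]
  refine Matrix.abs_orthogonal_conj_diagonal_apply_le V hV _ _ (fun p => ?_) x y
  obtain ⟨hp1, hp2⟩ := hμ p
  have hp0 : 0 < μ p := hlo.trans_le hp1
  rw [abs_mul, abs_pow, abs_inv, abs_of_pos hp0, div_eq_mul_inv _ lo]
  have habs : |1 - c⁻¹ * μ p| ≤ (hi - lo) / (hi + lo) := by
    have : 1 - c⁻¹ * μ p = (hi + lo - 2 * μ p) / (hi + lo) := by
      have : hi + lo ≠ 0 := by linarith
      rw [hc]; field_simp
    rw [this, abs_div, abs_of_pos (by linarith : 0 < hi + lo)]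
    gcongr
    · linarith
    · rw [abs_le]; constructor <;> linarith
  have hratio : 0 ≤ (hi - lo) / (hi + lo) := (abs_nonneg _).trans habs
  gcongr

/-- Exponential decay, in the grid distance, of the entries of the inverse of
`M ⊗ I + I ⊗ M` for tridiagonal `M`. -/
theorem Matrix.abs_inv_kroneckerSum_apply_le (n : ℕ) (M : Matrix (Fin n) (Fin n) ℝ)
    (hM : M.IsHermitian) (htri : ∀ a c : Fin n, 1 < |(a : ℤ) - (c : ℤ)| → M a c = 0)
    (lo hi : ℝ) (hlo : 0 < lo) (hev : ∀ p, lo ≤ hM.eigenvalues p ∧ hM.eigenvalues p ≤ hi)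
    (x y : Fin n × Fin n) :
    |(kroneckerMap (· * ·) M (1 : Matrix (Fin n) (Fin n) ℝ) +
        kroneckerMap (· * ·) (1 : Matrix (Fin n) (Fin n) ℝ) M)⁻¹ x y| ≤
      ((hi - lo) / (hi + lo)) ^
        (((x.1 : ℤ) - y.1).natAbs + ((x.2 : ℤ) - y.2).natAbs) / (2 * lo) := by
  set U : Matrix (Fin n) (Fin n) ℝ := ↑hM.eigenvectorUnitary
  have hUU : U * Uᵀ = 1 := by
    have := Matrix.mem_unitaryGroup_iff.mp hM.eigenvectorUnitary.2
    rwa [Matrix.star_eq_conjTranspose, Matrix.conjTranspose_eq_transpose_of_trivial] at this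
  have hspec : M = U * diagonal hM.eigenvalues * Uᵀ := by
    have := hM.spectral_theorem
    rw [Unitary.conjStarAlgAut_apply, Matrix.star_eq_conjTranspose,
      Matrix.conjTranspose_eq_transpose_of_trivial] at this
    exact this
  have h := Matrix.abs_inv_apply_le_of_dist
    (fun x y : Fin n × Fin n => ((x.1 : ℤ) - y.1).natAbs + ((x.2 : ℤ) - y.2).natAbs)
    (fun x => by simp) (fun x y z => by omega)
    (kroneckerMap (· * ·) M 1 + kroneckerMap (· * ·) 1 M) (kroneckerMap (· * ·) U U)
    (by rw [← Matrix.kroneckerMap_transpose, ← Matrix.mul_kronecker_mul, hUU,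
      Matrix.one_kronecker_one])
    (fun p => hM.eigenvalues p.1 + hM.eigenvalues p.2)
    (by
      have hd : diagonal (fun p : Fin n × Fin n => hM.eigenvalues p.1 + hM.eigenvalues p.2) =
          kroneckerMap (· * ·) (diagonal hM.eigenvalues) 1 +
            kroneckerMap (· * ·) 1 (diagonal hM.eigenvalues) := by
        rw [← Matrix.diagonal_one, Matrix.diagonal_kronecker_diagonal,
          Matrix.diagonal_kronecker_diagonal, Matrix.diagonal_add]
        simp
      rw [hd, Matrix.mul_add, Matrix.add_mul, ← Matrix.kroneckerMap_transpose]
      simp only [← Matrix.mul_kronecker_mul, Matrix.mul_one, hUU, ← hspec])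
    (fun x y hxy => by
      have hz : ∀ a b c d : Fin n, 1 < ((a : ℤ) - b).natAbs + ((c : ℤ) - d).natAbs →
          M a b * (1 : Matrix (Fin n) (Fin n) ℝ) c d = 0 := by
        intro a b c d habcd
        by_cases hcd : c = d
        · subst hcd
          rw [htri a b (by rw [Int.abs_eq_natAbs]; simp at habcd; omega), zero_mul]
        · rw [Matrix.one_apply_ne hcd, mul_zero]
      rw [Matrix.add_apply, Matrix.kroneckerMap_apply, Matrix.kroneckerMap_apply, hz _ _ _ _ hxy,
        mul_comm, hz _ _ _ _ (by omega), add_zero])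
    (2 * lo) (2 * hi) (by linarith)
    (fun p => ⟨by linarith [(hev p.1).1, (hev p.2).1], by linarith [(hev p.1).2, (hev p.2).2]⟩)
    x y
  rwa [← mul_sub, ← mul_add, mul_div_mul_left _ _ two_ne_zero] at h

theorem kronSum_eq_submatrix (n : ℕ) (M : Matrix (Fin n) (Fin n) ℝ) :
    kronSum n M = (kroneckerMap (· * ·) M 1 + kroneckerMap (· * ·) 1 M).submatrix
      finProdFinEquiv.symm finProdFinEquiv.symm := by
  ext k t
  simp only [kronSum, Matrix.submatrix_apply, Matrix.add_apply, Matrix.kroneckerMap_apply,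
    finProdFinEquiv_symm_apply, Matrix.one_apply, Fin.ext_iff, Fin.coe_divNat, Fin.coe_modNat,
    mul_ite, ite_mul, mul_one, one_mul, mul_zero, zero_mul]
  rw [add_comm]
  rfl

theorem mul_mul_rpow_mul_sqrt_le_add_pow_mul_sqrt (a b : ℝ) (ha : 0 < a) (hb : 0 < b) (d : ℕ)
    (hd : 2 ≤ d) :
    a * b * √((d : ℝ) + 1) * (b ^ 2 + a ^ 2) ^ (((d : ℝ) - 1) / 2) ≤
      (a + b) ^ d * √(b ^ 2 + a ^ 2) := by
  have hd' : (2 : ℝ) ≤ d := by exact_mod_cast hd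
  set s := b ^ 2 + a ^ 2 with hs
  have hs0 : 0 < s := by positivity
  have hsqrt : √((d : ℝ) + 1) ≤ d := Real.sqrt_le_iff.mpr ⟨by linarith, by nlinarith⟩
  have hsq : (a + b) ^ 2 = s * (1 + 2 * a * b / s) := by
    rw [hs]; field_simp; ring
  have hpow : (a + b) ^ d = s ^ ((d : ℝ) / 2) * (1 + 2 * a * b / s) ^ ((d : ℝ) / 2) := by
    rw [← Real.mul_rpow hs0.le (by positivity), ← hsq, ← Real.rpow_natCast (a + b) 2,
      ← Real.rpow_mul (by positivity), ← Real.rpow_natCast]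
    congr 1; push_cast; ring
  have hbern : (d : ℝ) / 2 * (2 * a * b / s) ≤ (1 + 2 * a * b / s) ^ ((d : ℝ) / 2) := by
    have := one_add_mul_self_le_rpow_one_add (s := 2 * a * b / s) (p := (d : ℝ) / 2)
      (by have : 0 ≤ 2 * a * b / s := by positivity
          linarith) (by linarith)
    linarith
  have hsplit : s ^ ((d : ℝ) / 2) * √s = s ^ (((d : ℝ) - 1) / 2) * s := by
    rw [Real.sqrt_eq_rpow, ← Real.rpow_add hs0, ← Real.rpow_add_one hs0.ne']
    congr 1; ring
  calc a * b * √((d : ℝ) + 1) * s ^ (((d : ℝ) - 1) / 2)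
      ≤ a * b * d * s ^ (((d : ℝ) - 1) / 2) := by gcongr
    _ = (s ^ (((d : ℝ) - 1) / 2) * s) * ((d : ℝ) / 2 * (2 * a * b / s)) := by field_simp
    _ = (s ^ ((d : ℝ) / 2) * √s) * ((d : ℝ) / 2 * (2 * a * b / s)) := by rw [hsplit]
    _ ≤ (s ^ ((d : ℝ) / 2) * √s) * (1 + 2 * a * b / s) ^ ((d : ℝ) / 2) := by gcongr
    _ = (a + b) ^ d * √s := by rw [hpow]; ring

theorem ratio_pow_div_le_explicit_bound (a b : ℝ) (ha : 0 < a) (hab : a < b) (d : ℕ)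
    (hd : 2 ≤ d) (N : ℝ) (hN : N = d - 1) :
    ((b - a) / (b + a)) ^ d / (2 * a) ≤
      (1 / (2 * √2)) * ((b - a) ^ (N + 1) / (b ^ 2 + a ^ 2) ^ (N / 2)) *
        (√(b ^ 2 + a ^ 2) / (b * a ^ 2)) * (1 / √N) * √(2 * N / (N + 2)) := by
  have hb : 0 < b := ha.trans hab
  have hd' : (2 : ℝ) ≤ d := by exact_mod_cast hd
  have hN0 : 0 < N := by linarith
  have key := mul_mul_rpow_mul_sqrt_le_add_pow_mul_sqrt a b ha hb d hd
  rw [show (d : ℝ) + 1 = N + 2 by linarith, ← hN] at key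
  rw [show N + 1 = d by linarith, Real.rpow_natCast, Real.sqrt_div (by positivity),
    Real.sqrt_mul (by norm_num)]
  have hP : 0 < (b ^ 2 + a ^ 2) ^ (N / 2) := by positivity
  have hQ : 0 < √(N + 2) := by positivity
  have hS : 0 < √(b ^ 2 + a ^ 2) := by positivity
  have h2 : 0 < √2 := by positivity
  have hNs : 0 < √N := by positivity
  have hX : 0 < (b - a) ^ d := pow_pos (by linarith) d
  rw [add_comm a b] at key
  have hY : 0 < (b + a) ^ d := by positivity
  rw [div_pow]
  generalize (b ^ 2 + a ^ 2) ^ (N / 2) = P at *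
  generalize √(b ^ 2 + a ^ 2) = S at *
  generalize √(N + 2) = Q at *
  generalize (b - a) ^ d = X at *
  generalize (b + a) ^ d = Y at *
  have hR : 1 / (2 * √2) * (X / P) * (S / (b * a ^ 2)) * (1 / √N) * (√2 * √N / Q) =
      X * S / (2 * P * b * a ^ 2 * Q) := by
    field_simp
  rw [hR, div_div, div_le_div_iff₀ (by positivity) (by positivity)]
  calc X * (2 * P * b * a ^ 2 * Q) = 2 * a * X * (a * b * Q * P) := by ring
    _ ≤ 2 * a * X * (Y * S) := by gcongr
    _ = X * S * (Y * (2 * a)) := by ring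

/-- Proposition 2.3 (ii): explicit bound in terms of the index distance
`𝔫₁ = |ℓ-i| + |m-j| - 1` when exactly one grid coordinate coincides. -/
theorem kronSum_inv_entry_explicit_bound_oneEqual
    (n : ℕ) (M : Matrix (Fin n) (Fin n) ℝ) (hM : M.PosDef)
    (htri : ∀ a c : Fin n, 1 < |(a : ℤ) - (c : ℤ)| → M a c = 0)
    (lammin lammax : ℝ)
    (hmin : IsLeast (Set.range hM.1.eigenvalues) lammin)
    (hmax : IsGreatest (Set.range hM.1.eigenvalues) lammax)
    (hlt : lammin < lammax)
    (k t : ℕ) (hk1 : 1 ≤ k) (hk2 : k ≤ n * n) (ht1 : 1 ≤ t) (ht2 : t ≤ n * n)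
    (i j ℓ m : ℕ)
    (hj : j = (t - 1) / n + 1) (hi : i = t - n * ((t - 1) / n))
    (hm : m = (k - 1) / n + 1) (hl : ℓ = k - n * ((k - 1) / n))
    (hone : (ℓ = i ∧ m ≠ j) ∨ (ℓ ≠ i ∧ m = j))
    (𝔫 : ℝ) (h𝔫 : 𝔫 = |(ℓ : ℝ) - (i : ℝ)| + |(m : ℝ) - (j : ℝ)| - 1)
    (h𝔫pos : 0 < 𝔫) :
    |(kronSum n M)⁻¹ ⟨k - 1, by omega⟩ ⟨t - 1, by omega⟩| ≤
      (1 / (2 * Real.sqrt 2)) *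
        ((lammax - lammin) ^ (𝔫 + 1) / (lammax ^ 2 + lammin ^ 2) ^ (𝔫 / 2)) *
        (Real.sqrt (lammax ^ 2 + lammin ^ 2) / (lammax * lammin ^ 2)) *
        (1 / Real.sqrt 𝔫) * Real.sqrt (2 * 𝔫 / (𝔫 + 2)) := by
  obtain ⟨p₀, hp₀⟩ := hmin.1
  have ha : 0 < lammin := hp₀ ▸ hM.eigenvalues_pos p₀
  have hev : ∀ p, lammin ≤ hM.1.eigenvalues p ∧ hM.1.eigenvalues p ≤ lammax :=
    fun p => ⟨hmin.2 ⟨p, rfl⟩, hmax.2 ⟨p, rfl⟩⟩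
  rw [kronSum_eq_submatrix, Matrix.inv_submatrix_equiv, Matrix.submatrix_apply]
  refine (Matrix.abs_inv_kroneckerSum_apply_le n M hM.1 htri lammin lammax ha hev _ _).trans ?_
  simp only [finProdFinEquiv_symm_apply, Fin.coe_divNat, Fin.coe_modNat]
  set d : ℕ := ((((k - 1) / n : ℕ) : ℤ) - ((t - 1) / n : ℕ)).natAbs +
    ((((k - 1) % n : ℕ) : ℤ) - ((t - 1) % n : ℕ)).natAbs with hd
  have hmod : ∀ u : ℕ, 1 ≤ u → u - n * ((u - 1) / n) = (u - 1) % n + 1 := fun u hu => by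
    have := Nat.div_add_mod (u - 1) n
    omega
  have hNd : 𝔫 = d - 1 := by
    rw [h𝔫, hl, hi, hm, hj, hmod k hk1, hmod t ht1, hd]
    generalize (k - 1) / n = q, (t - 1) / n = q', (k - 1) % n = r, (t - 1) % n = r'
    push_cast [Nat.cast_natAbs]
    rw [add_sub_add_right_eq_sub, add_sub_add_right_eq_sub, add_comm]
  have hd2 : 2 ≤ d := by
    have : (1 : ℝ) < d := by linarith
    exact_mod_cast this
  exact ratio_pow_div_le_explicit_bound lammin lammax ha hlt d hd2 𝔫 hNd
end

section
/- Let M be an n×n real symmetric positive definite b-banded matrix with smallest eigenvalue λ_min and largest eigenvalue λ_max, λ_min < λ_max, and let S = M ⊗ I_n + I_n ⊗ M. For k, t ∈ {1, …, n²} set j = ⌊(t−1)/n⌋ + 1, i = t − n⌊(t−1)/n⌋, m = ⌊(k−1)/n⌋ + 1, ℓ = k − n⌊(k−1)/n⌋. For ω ∈ ℝ let α(ω) = (√(λ_min² + ω²) + √(λ_max² + ω²))/(λ_max − λ_min) and R(ω) = α(ω) + √(α(ω)² − 1). If i ≠ ℓ and j ≠ m, then |(S⁻¹)_{k,t}| ≤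 (1/(2π)) · (64/(λ_max − λ_min)²) · ∫_{−∞}^{∞} (R(ω)²/(R(ω)² − 1)²)² · (1/R(ω))^{|i−ℓ|/b + |j−m|/b − 2} dω. -/
open MeasureTheory Real Matrix

/-- The value of a Chebyshev polynomial at a point of the Joukowski parametrization. -/
theorem chebyshev_T_eval_joukowski {w : ℂ} (hw : w ≠ 0) (n : ℤ) :
    (Polynomial.Chebyshev.T ℂ n).eval ((w + w⁻¹) / 2) = (w ^ n + (w ^ n)⁻¹) / 2 := by
  have h := Polynomial.Chebyshev.T_complex_cosh (Complex.log w) n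
  have hn : Complex.exp (n * Complex.log w) = w ^ n := by
    rw [Complex.exp_int_mul, Complex.exp_log hw]
  rwa [Complex.cosh, Complex.cosh, Complex.exp_neg, Complex.exp_neg, hn,
    Complex.exp_log hw] at h

/-- Bernstein-type approximation of `x ↦ (x - z)⁻¹` on `[-1, 1]` by polynomials of degree at most
`k`, where `z = (u + u⁻¹) / 2` and `1 < ‖u‖`. -/
theorem exists_polynomial_approx_inv_sub {u : ℂ} (hu : 1 < ‖u‖) (k : ℕ) :
    ∃ p : Polynomial ℂ, p.natDegree ≤ k ∧ ∀ x : ℝ, x ∈ Set.Icc (-1 : ℝ) 1 →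
      ‖((x : ℂ) - (u + u⁻¹) / 2)⁻¹ - p.eval (x : ℂ)‖ ≤
        4 * (‖u‖ ^ 2 / (‖u‖ ^ 2 - 1) ^ 2) * (1 / ‖u‖) ^ k := by
  set r := ‖u‖ with hr
  set z := (u + u⁻¹) / 2 with hz
  set c := (starRingEnd ℂ) u with hc
  have hr0 : 0 < r := by linarith
  have hu0 : u ≠ 0 := norm_pos_iff.mp hr0
  have hcu : c * u = (r : ℂ) ^ 2 := by
    rw [hc, mul_comm, Complex.mul_conj, Complex.normSq_eq_norm_sq]; push_cast; rfl
  have hr2 : 1 < r ^ 2 := by nlinarith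
  have h1 : (1 : ℂ) - c * u ≠ 0 := by
    rw [hcu]; intro h
    have : (1 : ℝ) - r ^ 2 = 0 := by exact_mod_cast h
    linarith
  have h2n : r ^ 2 - 1 ≤ ‖u ^ 2 - 1‖ := by
    have := norm_sub_norm_le (u ^ 2) 1
    simpa [norm_pow] using this
  have h2 : u ^ 2 - 1 ≠ 0 := by
    rw [← norm_pos_iff]; linarith
  set K : ℂ := 2 * u * (u ^ k)⁻¹ / ((1 - c * u) * (u ^ 2 - 1)) with hK
  open Polynomial in
  set q : Polynomial ℂ := C K * (C (u + c) * Chebyshev.T ℂ k - Chebyshev.T ℂ (k - 1)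
    - C (c * u) * Chebyshev.T ℂ (k + 1)) with hq
  have heval : ∀ w : ℂ, w ≠ 0 → q.eval ((w + w⁻¹) / 2) =
      K / 2 * (w ^ k * w⁻¹ * ((1 - c * w) * (u * w - 1)) +
        (w ^ k)⁻¹ * w⁻¹ * ((w - c) * (u - w))) := by
    intro w hw
    simp only [hq, Polynomial.eval_mul, Polynomial.eval_sub, Polynomial.eval_C,
      chebyshev_T_eval_joukowski hw, zpow_natCast, zpow_add₀ hw, zpow_sub₀ hw, zpow_one]
    field_simp
    ring
  have hqz : q.eval z = 1 := by
    have h1' : 1 - u * c ≠ 0 := by rwa [mul_comm u c]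
    rw [hz, heval u hu0, hK]
    field_simp
    ring
  have hqdeg : q.natDegree ≤ k + 1 := by
    have hT : ∀ m : ℤ, m.natAbs ≤ k + 1 → (Polynomial.Chebyshev.T ℂ m).natDegree ≤ k + 1 := by
      intro m hm; rwa [Polynomial.Chebyshev.natDegree_T]
    refine (Polynomial.natDegree_C_mul_le _ _).trans ?_
    refine Polynomial.natDegree_sub_le_of_le (Polynomial.natDegree_sub_le_of_le
      ((Polynomial.natDegree_C_mul_le _ _).trans (hT _ (by omega))) (hT _ (by omega)))
      ((Polynomial.natDegree_C_mul_le _ _).trans (hT _ (by omega))) |>.trans ?_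
    simp
  have hroot : (1 - q).IsRoot z := by simp [Polynomial.IsRoot, hqz]
  obtain ⟨p, hp⟩ := Polynomial.dvd_iff_isRoot.mpr hroot
  refine ⟨p, ?_, ?_⟩
  · by_cases hp0 : p = 0
    · simp [hp0]
    have hd : (1 - q).natDegree = 1 + p.natDegree := by
      rw [hp, Polynomial.natDegree_mul (Polynomial.X_sub_C_ne_zero z) hp0,
        Polynomial.natDegree_X_sub_C]
    have : (1 - q).natDegree ≤ k + 1 :=
      (Polynomial.natDegree_sub_le_of_le (by simp) hqdeg).trans (max_self _).le
    omega
  · intro x hx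
    obtain ⟨w, hwn, hwx⟩ : ∃ w : ℂ, ‖w‖ = 1 ∧ (x : ℂ) = (w + w⁻¹) / 2 := by
      refine ⟨Complex.exp (arccos x * Complex.I), Complex.norm_exp_ofReal_mul_I _, ?_⟩
      rw [← Complex.exp_neg, ← neg_mul, ← Complex.cos, ← Complex.ofReal_cos,
        Real.cos_arccos hx.1 hx.2]
    have hw0 : w ≠ 0 := by rw [← norm_pos_iff, hwn]; norm_num
    have hwinv : w⁻¹ = (starRingEnd ℂ) w := Complex.inv_eq_conj hwn
    have hxz : (x : ℂ) - z = (w - u) * (u * w - 1) / (2 * u * w) := by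
      rw [hwx, hz]; field_simp; ring
    have ha : ‖1 - c * w‖ = ‖w - u‖ := by
      have : 1 - c * w = w * (starRingEnd ℂ) (w - u) := by
        rw [map_sub, ← hwinv, mul_sub, mul_inv_cancel₀ hw0]; ring
      rw [this, norm_mul, hwn, one_mul, RCLike.norm_conj]
    have hb : ‖w - c‖ = ‖u * w - 1‖ := by
      have : u * w - 1 = - (w * (starRingEnd ℂ) (w - c)) := by
        rw [map_sub, ← hwinv, mul_sub, mul_inv_cancel₀ hw0, hc, Complex.conj_conj]; ring
      rw [this, norm_neg, norm_mul, hwn, one_mul, RCLike.norm_conj]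
    have hne : (x : ℂ) - z ≠ 0 := by
      rw [hxz]
      refine div_ne_zero (mul_ne_zero ?_ ?_) (by simp [hu0, hw0])
      · intro h
        have : w = u := by linear_combination h
        rw [← this, hwn] at hr; linarith
      · intro h
        have : u * w = 1 := by linear_combination h
        have := congrArg norm this
        rw [norm_mul, hwn, ← hr, norm_one] at this; linarith
    have herr : ((x : ℂ) - z)⁻¹ - p.eval (x : ℂ) = q.eval (x : ℂ) / ((x : ℂ) - z) := by
      have h := congrArg (Polynomial.eval (x : ℂ)) hp
      simp only [Polynomial.eval_sub, Polynomial.eval_one, Polynomial.eval_mul, Polynomial.eval_X,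
        Polynomial.eval_C] at h
      rw [eq_div_iff hne, sub_mul, inv_mul_cancel₀ hne]
      linear_combination h
    have hqn : ‖q.eval (x : ℂ)‖ ≤ ‖K‖ * (‖w - u‖ * ‖u * w - 1‖) := by
      rw [hwx, heval w hw0, norm_mul]
      have : ‖w ^ k * w⁻¹ * ((1 - c * w) * (u * w - 1)) +
        (w ^ k)⁻¹ * w⁻¹ * ((w - c) * (u - w))‖ ≤ 2 * (‖w - u‖ * ‖u * w - 1‖) := by
        refine (norm_add_le _ _).trans (le_of_eq ?_)
        simp only [norm_mul, norm_inv, norm_pow, hwn, ha, hb, norm_sub_rev u w]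
        ring
      refine (mul_le_mul_of_nonneg_left this (norm_nonneg _)).trans (le_of_eq ?_)
      rw [norm_div]; simp; ring
    have hKn : ‖K‖ ≤ 2 * r * (1 / r) ^ k / (r ^ 2 - 1) ^ 2 := by
      have h1n : ‖1 - c * u‖ = r ^ 2 - 1 := by
        rw [hcu, norm_sub_rev, ← Complex.ofReal_pow, ← Complex.ofReal_one, ← Complex.ofReal_sub,
          Complex.norm_real, Real.norm_of_nonneg (by linarith)]
      rw [hK, norm_div, norm_mul (1 - c * u), h1n, norm_mul, norm_mul, norm_inv, norm_pow, ← hr,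
        Complex.norm_ofNat, one_div, inv_pow, sq (r ^ 2 - 1)]
      have : 0 < r ^ 2 - 1 := by linarith
      gcongr
    have hxn : ‖(x : ℂ) - z‖ = ‖w - u‖ * ‖u * w - 1‖ / (2 * r) := by
      rw [hxz]; simp [hwn, ← hr]
    rw [herr, norm_div, div_le_iff₀ (norm_pos_iff.mpr hne), hxn]
    refine hqn.trans ((mul_le_mul_of_nonneg_right hKn (by positivity)).trans (le_of_eq ?_))
    field_simp
    ring

/-- Approximation of the resolvent function `x ↦ (x + ω i)⁻¹` on `[lo, hi]` by polynomials. -/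
theorem exists_polynomial_approx_resolvent {lo hi : ℝ} (h0 : 0 < lo) (hlt : lo < hi) (ω : ℝ)
    {α R : ℝ} (hα : α = (√(lo ^ 2 + ω ^ 2) + √(hi ^ 2 + ω ^ 2)) / (hi - lo))
    (hR : R = α + √(α ^ 2 - 1)) (k : ℕ) :
    ∃ p : Polynomial ℂ, p.natDegree ≤ k ∧ ∀ x : ℝ, x ∈ Set.Icc lo hi →
      ‖((x : ℂ) + ω * Complex.I)⁻¹ - p.eval (x : ℂ)‖ ≤
        8 / (hi - lo) * (R ^ 2 / (R ^ 2 - 1) ^ 2) * (1 / R) ^ k := by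
  have hd : 0 < hi - lo := by linarith
  set h : ℝ := (hi - lo) / 2 with hh
  have hhp : 0 < h := by positivity
  set z : ℂ := -(((lo + hi) / 2 : ℝ) + ω * Complex.I) / h with hz
  have hhc : (h : ℂ) ≠ 0 := by exact_mod_cast hhp.ne'
  obtain ⟨u, hu1, huz⟩ : ∃ u : ℂ, 1 ≤ ‖u‖ ∧ z = (u + u⁻¹) / 2 := by
    obtain ⟨s, hs⟩ := IsAlgClosed.exists_pow_nat_eq (z ^ 2 - 1) (n := 2) (by norm_num)
    have hprod : (z + s) * (z - s) = 1 := by linear_combination -hs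
    rcases le_total 1 ‖z + s‖ with hle | hle
    · exact ⟨z + s, hle, by rw [inv_eq_of_mul_eq_one_right hprod]; ring⟩
    · refine ⟨z - s, ?_, by rw [inv_eq_of_mul_eq_one_left hprod]; ring⟩
      have := congrArg norm hprod
      rw [norm_mul, norm_one] at this
      nlinarith [norm_nonneg (z + s), norm_nonneg (z - s)]
  set r := ‖u‖ with hr
  have hr0 : 0 < r := by linarith
  have hu0 : u ≠ 0 := norm_pos_iff.mp hr0
  have hz1 : ‖z + 1‖ = √(lo ^ 2 + ω ^ 2) / h := by
    have : z + 1 = -((lo : ℂ) + ω * Complex.I) / h := by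
      rw [hz]; field_simp; rw [hh]; push_cast; ring
    rw [this, norm_div, norm_neg, Complex.norm_add_mul_I, Complex.norm_real,
      Real.norm_of_nonneg hhp.le]
  have hz2 : ‖z - 1‖ = √(hi ^ 2 + ω ^ 2) / h := by
    have : z - 1 = -((hi : ℂ) + ω * Complex.I) / h := by
      rw [hz]; field_simp; rw [hh]; push_cast; ring
    rw [this, norm_div, norm_neg, Complex.norm_add_mul_I, Complex.norm_real,
      Real.norm_of_nonneg hhp.le]
  have hpar : ‖z + 1‖ + ‖z - 1‖ = r + r⁻¹ := by
    have e1 : z + 1 = (u + 1) ^ 2 / (2 * u) := by rw [huz]; field_simp; ring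
    have e2 : z - 1 = (u - 1) ^ 2 / (2 * u) := by rw [huz]; field_simp; ring
    have := parallelogram_law_with_norm ℝ u 1
    rw [norm_one, ← hr] at this
    rw [e1, e2, norm_div, norm_div, norm_pow, norm_pow, norm_mul, Complex.norm_ofNat, ← hr]
    field_simp
    linarith
  have hαr : α = (r + r⁻¹) / 2 := by
    rw [← hpar, hz1, hz2, hα, hh]; field_simp
  have hα1 : 1 < α := by
    rw [hα, lt_div_iff₀ hd, one_mul]
    have e1 : lo ≤ √(lo ^ 2 + ω ^ 2) := Real.le_sqrt_of_sq_le (by nlinarith)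
    have e2 : hi ≤ √(hi ^ 2 + ω ^ 2) := Real.le_sqrt_of_sq_le (by nlinarith)
    linarith
  have hRr : R = r := by
    have : α ^ 2 - 1 = ((r - r⁻¹) / 2) ^ 2 := by rw [hαr]; field_simp; ring
    have hri : r⁻¹ ≤ 1 := inv_le_one_of_one_le₀ hu1
    rw [hR, this, Real.sqrt_sq (by linarith), hαr]; ring
  have hr1 : 1 < r := by
    rcases hu1.lt_or_eq with h' | h'
    · exact h'
    · rw [← h'] at hαr; norm_num at hαr; linarith
  obtain ⟨p, hpd, hp⟩ := exists_polynomial_approx_inv_sub hr1 k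
  open Polynomial in
  refine ⟨C ((h : ℂ)⁻¹) * p.comp (C ((h : ℂ)⁻¹) * (X - C (((lo + hi) / 2 : ℝ) : ℂ))), ?_, ?_⟩
  · refine (Polynomial.natDegree_C_mul_le _ _).trans (Polynomial.natDegree_comp_le.trans ?_)
    calc _ ≤ k * 1 := Nat.mul_le_mul hpd
            ((Polynomial.natDegree_C_mul_le _ _).trans (Polynomial.natDegree_X_sub_C_le _))
      _ = k := mul_one k
  · intro x hx
    set y : ℝ := h⁻¹ * (x - (lo + hi) / 2) with hy
    have hym : y ∈ Set.Icc (-1 : ℝ) 1 := by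
      rw [hy, inv_mul_eq_div]
      constructor
      · rw [le_div_iff₀ hhp]; linarith [hx.1]
      · rw [div_le_iff₀ hhp]; linarith [hx.2]
    have hyc : (h : ℂ)⁻¹ * ((x : ℂ) - (((lo + hi) / 2 : ℝ) : ℂ)) = (y : ℂ) := by
      rw [hy]; push_cast; ring
    have hxy : ((x : ℂ) + ω * Complex.I)⁻¹ = (h : ℂ)⁻¹ * ((y : ℂ) - (u + u⁻¹) / 2)⁻¹ := by
      rw [← mul_inv, ← huz, ← hyc, hz]
      congr 1
      field_simp
      ring
    simp only [Polynomial.eval_mul, Polynomial.eval_C, Polynomial.eval_comp, Polynomial.eval_sub,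
      Polynomial.eval_X, hyc]
    rw [hxy, ← mul_sub, norm_mul, norm_inv, Complex.norm_real, Real.norm_of_nonneg hhp.le]
    refine (mul_le_mul_of_nonneg_left (hp y hym) (by positivity)).trans (le_of_eq ?_)
    rw [hRr, hh]
    field_simp
    ring

/-- Natural powers of a `b`-banded matrix are banded: `M ^ r` has bandwidth `b * r`. -/
theorem banded_pow_apply_eq_zero {n b : ℕ} {M : Matrix (Fin n) (Fin n) ℝ}
    (hband : ∀ a c : Fin n, (b : ℤ) < |(a : ℤ) - (c : ℤ)| → M a c = 0) (r : ℕ) (a c : Fin n)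
    (h : (b : ℤ) * r < |(a : ℤ) - (c : ℤ)|) : (M ^ r) a c = 0 := by
  induction r generalizing c with
  | zero =>
    rw [pow_zero, Matrix.one_apply_ne]
    rintro rfl
    simp at h
  | succ r ih =>
    rw [pow_succ, Matrix.mul_apply]
    refine Finset.sum_eq_zero fun x _ => ?_
    by_cases hx : (b : ℤ) * r < |(a : ℤ) - (x : ℤ)|
    · rw [ih x hx, zero_mul]
    · rw [hband x c, mul_zero]
      have := abs_sub_le (a : ℤ) x c
      push_cast at h
      linarith

/-- Entries of the powers of a real symmetric matrix, in terms of eigenvalues and eigenvectors. -/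
theorem pow_apply_eq_sum {n : ℕ} {M U : Matrix (Fin n) (Fin n) ℝ} {d : Fin n → ℝ}
    (hU : Uᵀ * U = 1) (hU' : U * Uᵀ = 1) (hMU : M = U * diagonal d * Uᵀ) (r : ℕ) (a c : Fin n) :
    (M ^ r) a c = ∑ s, U a s * d s ^ r * U c s := by
  have h : M ^ r = U * diagonal d ^ r * Uᵀ := by
    induction r with
    | zero => simp [hU']
    | succ r ih =>
      rw [pow_succ, ih, hMU, pow_succ]
      calc U * diagonal d ^ r * Uᵀ * (U * diagonal d * Uᵀ)
          = U * diagonal d ^ r * (Uᵀ * U) * diagonal d * Uᵀ := by simp only [Matrix.mul_assoc]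
        _ = _ := by rw [hU, Matrix.mul_one]; simp only [Matrix.mul_assoc]
  rw [h, Matrix.diagonal_pow, Matrix.mul_apply]
  simp [Matrix.mul_diagonal]

/-- A spectral function of a banded symmetric matrix which is close to a polynomial of low degree
has small entries far from the diagonal. -/
theorem norm_sum_spectral_le {n b : ℕ} {M U : Matrix (Fin n) (Fin n) ℝ} {d : Fin n → ℝ}
    (hU : Uᵀ * U = 1) (hU' : U * Uᵀ = 1) (hMU : M = U * diagonal d * Uᵀ)
    (hband : ∀ a c : Fin n, (b : ℤ) < |(a : ℤ) - (c : ℤ)| → M a c = 0)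
    (f : Fin n → ℂ) (p : Polynomial ℂ) {E : ℝ}
    (hE : ∀ s, ‖f s - p.eval (d s : ℂ)‖ ≤ E) (a c : Fin n)
    (hac : (b : ℤ) * p.natDegree < |(a : ℤ) - (c : ℤ)|) :
    ‖∑ s, (U a s : ℂ) * U c s * f s‖ ≤ E := by
  have hrow : ∀ a, ∑ s, U a s ^ 2 = 1 := by
    intro a
    have := congrFun (congrFun hU' a) a
    simpa [Matrix.mul_apply, sq] using this
  have hE0 : 0 ≤ E := (norm_nonneg _).trans (hE a)
  have hp : ∑ s, (U a s : ℂ) * U c s * p.eval (d s : ℂ) = 0 := by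
    simp only [Polynomial.eval_eq_sum_range, Finset.mul_sum]
    rw [Finset.sum_comm]
    refine Finset.sum_eq_zero fun r hr => ?_
    have hr' : r ≤ p.natDegree := Nat.lt_succ_iff.mp (Finset.mem_range.mp hr)
    have h0 := banded_pow_apply_eq_zero hband r a c
      (lt_of_le_of_lt (mul_le_mul_of_nonneg_left (by exact_mod_cast hr') (by positivity)) hac)
    rw [pow_apply_eq_sum hU hU' hMU] at h0
    have h1 := congrArg (fun x : ℝ => p.coeff r * (x : ℂ)) h0
    simp only [Complex.ofReal_sum, Complex.ofReal_mul, Complex.ofReal_pow, Complex.ofReal_zero,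
      mul_zero, Finset.mul_sum] at h1
    rw [← h1]
    exact Finset.sum_congr rfl fun s _ => by ring
  have hsub : ∑ s, (U a s : ℂ) * U c s * f s =
      ∑ s, (U a s : ℂ) * U c s * (f s - p.eval (d s : ℂ)) := by
    simp only [mul_sub, Finset.sum_sub_distrib, hp, sub_zero]
  rw [hsub]
  calc _ ≤ ∑ s, ‖(U a s : ℂ) * U c s * (f s - p.eval (d s : ℂ))‖ := norm_sum_le _ _
    _ ≤ ∑ s, (U a s ^ 2 + U c s ^ 2) / 2 * E := by
        refine Finset.sum_le_sum fun s _ => ?_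
        rw [norm_mul, norm_mul, Complex.norm_real, Complex.norm_real, Real.norm_eq_abs,
          Real.norm_eq_abs]
        refine mul_le_mul ?_ (hE s) (norm_nonneg _) (by positivity)
        nlinarith [sq_nonneg (|U a s| - |U c s|), sq_abs (U a s), sq_abs (U c s)]
    _ = E := by
        rw [← Finset.sum_mul, ← Finset.sum_div, Finset.sum_add_distrib, hrow, hrow]; ring

/-- Spectral formula for the inverse of a Kronecker sum. -/
theorem kronSum_inv_apply {n : ℕ} {M U : Matrix (Fin n) (Fin n) ℝ} {d : Fin n → ℝ}
    (hU : Uᵀ * U = 1) (hU' : U * Uᵀ = 1) (hMU : M = U * diagonal d * Uᵀ) (hd : ∀ s, 0 < d s)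
    (k t : Fin (n * n)) :
    (kronSum n M)⁻¹ k t = ∑ s, ∑ s', U k.modNat s * U t.modNat s *
      (U k.divNat s' * U t.divNat s') / (d s + d s') := by
  have hMUs : ∀ a s, ∑ c, M a c * U c s = d s * U a s := by
    intro a s
    have h : M * U = U * diagonal d := by
      rw [hMU, Matrix.mul_assoc, hU, Matrix.mul_one]
    have := congrFun (congrFun h a) s
    rw [Matrix.mul_apply, Matrix.mul_diagonal] at this
    rw [this, mul_comm]
  have hrow : ∀ a c, ∑ s, U a s * U c s = if a = c then 1 else 0 := by
    intro a c
    have := congrFun (congrFun hU' a) c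
    simpa [Matrix.mul_apply, Matrix.one_apply] using this
  set W : Matrix (Fin (n * n)) (Fin (n * n)) ℝ := fun k t => ∑ s, ∑ s',
    U k.modNat s * U t.modNat s * (U k.divNat s' * U t.divNat s') / (d s + d s') with hW
  have hS : ∀ k : Fin (n * n), ∀ x y : Fin n, kronSum n M k (finProdFinEquiv (x, y)) =
      (if k.divNat = x then M k.modNat y else 0) + (if k.modNat = y then M k.divNat x else 0) := by
    intro k x y
    have hn : 0 < n := x.pos
    have e1 : ((finProdFinEquiv (x, y) : Fin (n * n)) : ℕ) / n = x := by
      simp [finProdFinEquiv, Nat.add_mul_div_left _ _ hn, Nat.div_eq_of_lt y.2]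
    have e2 : ((finProdFinEquiv (x, y) : Fin (n * n)) : ℕ) % n = y := by
      simp [finProdFinEquiv, Nat.mod_eq_of_lt y.2]
    simp only [kronSum, e1, e2, Fin.ext_iff, Fin.coe_divNat, Fin.coe_modNat]
    rfl
  have hmul : kronSum n M * W = 1 := by
    ext k t
    rw [Matrix.mul_apply, ← finProdFinEquiv.sum_comp, Fintype.sum_prod_type]
    have hWe : ∀ x y : Fin n, W (finProdFinEquiv (x, y)) t = ∑ s, ∑ s',
        U y s * U t.modNat s * (U x s' * U t.divNat s') / (d s + d s') := by
      intro x y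
      have e := finProdFinEquiv.symm_apply_apply (x, y)
      have e1 : (finProdFinEquiv (x, y)).divNat = x := congrArg Prod.fst e
      have e2 : (finProdFinEquiv (x, y)).modNat = y := congrArg Prod.snd e
      rw [hW]; simp only [e1, e2]
    simp only [hS, hWe, add_mul, Finset.sum_add_distrib, ite_mul, zero_mul]
    have h1 : ∑ x, ∑ y, (if k.divNat = x then M k.modNat y * ∑ s, ∑ s',
        U y s * U t.modNat s * (U x s' * U t.divNat s') / (d s + d s') else 0) =
        ∑ s, ∑ s', d s * (U k.modNat s * U t.modNat s * (U k.divNat s' * U t.divNat s')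
          / (d s + d s')) := by
      rw [Finset.sum_comm]
      simp only [Finset.sum_ite_eq, Finset.mem_univ, if_true, Finset.mul_sum]
      rw [Finset.sum_comm]
      refine Finset.sum_congr rfl fun s _ => ?_
      rw [Finset.sum_comm]
      refine Finset.sum_congr rfl fun s' _ => ?_
      have := congrArg (· * (U t.modNat s * (U k.divNat s' * U t.divNat s') / (d s + d s')))
        (hMUs k.modNat s)
      simp only [Finset.sum_mul] at this
      exact (Finset.sum_congr rfl fun i _ => by ring).trans (this.trans (by ring))
    have h2 : ∑ x, ∑ y, (if k.modNat = y then M k.divNat x * ∑ s, ∑ s',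
        U y s * U t.modNat s * (U x s' * U t.divNat s') / (d s + d s') else 0) =
        ∑ s, ∑ s', d s' * (U k.modNat s * U t.modNat s * (U k.divNat s' * U t.divNat s')
          / (d s + d s')) := by
      simp only [Finset.sum_ite_eq, Finset.mem_univ, if_true, Finset.mul_sum]
      rw [Finset.sum_comm]
      refine Finset.sum_congr rfl fun s _ => ?_
      rw [Finset.sum_comm]
      refine Finset.sum_congr rfl fun s' _ => ?_
      have := congrArg (· * (U t.divNat s' * (U k.modNat s * U t.modNat s) / (d s + d s')))
        (hMUs k.divNat s')
      simp only [Finset.sum_mul] at this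
      exact (Finset.sum_congr rfl fun i _ => by ring).trans (this.trans (by ring))
    rw [h1, h2, ← Finset.sum_add_distrib]
    have h3 : ∀ s, ∑ s', d s * (U k.modNat s * U t.modNat s * (U k.divNat s' * U t.divNat s')
          / (d s + d s')) + ∑ s', d s' * (U k.modNat s * U t.modNat s *
          (U k.divNat s' * U t.divNat s') / (d s + d s')) =
        U k.modNat s * U t.modNat s * ∑ s', U k.divNat s' * U t.divNat s' := by
      intro s
      rw [← Finset.sum_add_distrib, Finset.mul_sum]
      refine Finset.sum_congr rfl fun s' _ => ?_
      have : d s + d s' ≠ 0 := (add_pos (hd s) (hd s')).ne'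
      field_simp
    simp only [h3, ← Finset.sum_mul, hrow, Matrix.one_apply]
    have hkt : k = t ↔ k.modNat = t.modNat ∧ k.divNat = t.divNat := by
      rw [← finProdFinEquiv.symm.injective.eq_iff, Prod.ext_iff, and_comm]; rfl
    simp only [hkt]
    split_ifs <;> simp_all
  rw [Matrix.inv_eq_right_inv hmul]

/-- The Poisson kernel of the half-plane is integrable. -/
theorem integrable_poisson_kernel {a : ℝ} (ha : 0 < a) :
    Integrable (fun ω : ℝ => a / (a ^ 2 + ω ^ 2)) := by
  have h := (integrable_inv_one_add_sq.comp_div ha.ne').const_mul a⁻¹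
  refine h.congr (Filter.Eventually.of_forall fun ω => ?_)
  have : a ^ 2 + ω ^ 2 ≠ 0 := by positivity
  simp only
  field_simp

/-- The Poisson kernel of the half-plane has total mass `π`. -/
theorem integral_poisson_kernel {a : ℝ} (ha : 0 < a) :
    ∫ ω : ℝ, a / (a ^ 2 + ω ^ 2) = π := by
  have h : ∀ ω : ℝ, a / (a ^ 2 + ω ^ 2) = a⁻¹ * (1 + (ω / a) ^ 2)⁻¹ := by
    intro ω
    have : a ^ 2 + ω ^ 2 ≠ 0 := by positivity
    field_simp
  simp only [h]
  rw [integral_const_mul, Measure.integral_comp_div (fun x : ℝ => (1 + x ^ 2)⁻¹),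
    integral_univ_inv_one_add_sq, abs_of_pos ha, smul_eq_mul, ← mul_assoc,
    inv_mul_cancel₀ ha.ne', one_mul]

/-- The real part of `1 / ((x + iω) (y - iω))` as a combination of Poisson kernels. -/
theorem re_resolvent_mul_resolvent {x y : ℝ} (hx : 0 < x) (hy : 0 < y) (ω : ℝ) :
    (((x : ℂ) + ω * Complex.I)⁻¹ * ((y : ℂ) + (-ω : ℝ) * Complex.I)⁻¹).re =
      (x / (x ^ 2 + ω ^ 2) + y / (y ^ 2 + ω ^ 2)) / (x + y) := by
  have h1 : x ^ 2 + ω ^ 2 ≠ 0 := by positivity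
  have h2 : y ^ 2 + ω ^ 2 ≠ 0 := by positivity
  have h3 : x + y ≠ 0 := by positivity
  rw [Complex.mul_re, Complex.inv_re, Complex.inv_re, Complex.inv_im, Complex.inv_im,
    Complex.normSq_add_mul_I, Complex.normSq_add_mul_I]
  simp only [Complex.add_re, Complex.ofReal_re, Complex.re_ofReal_mul, Complex.I_re,
    mul_zero, add_zero, Complex.add_im, Complex.ofReal_im, Complex.im_ofReal_mul, Complex.I_im,
    mul_one, zero_add, neg_sq]
  field_simp
  ring

/-- A double sum of reciprocals `1 / (d s + d s')` as an integral of products of resolvents. -/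
theorem sum_sum_div_eq_integral {ι : Type*} [Fintype ι] {d : ι → ℝ} (hd : ∀ s, 0 < d s)
    (f g : ι → ℝ) :
    ∑ s, ∑ s', f s * g s' / (d s + d s') = 1 / (2 * π) * ∫ ω : ℝ,
      ((∑ s, (f s : ℂ) * ((d s : ℂ) + ω * Complex.I)⁻¹) *
        (∑ s', (g s' : ℂ) * ((d s' : ℂ) + (-ω : ℝ) * Complex.I)⁻¹)).re := by
  have h : ∀ ω : ℝ, ((∑ s, (f s : ℂ) * ((d s : ℂ) + ω * Complex.I)⁻¹) *
        (∑ s', (g s' : ℂ) * ((d s' : ℂ) + (-ω : ℝ) * Complex.I)⁻¹)).re =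
      ∑ s, ∑ s', f s * g s' / (d s + d s') *
        (d s / (d s ^ 2 + ω ^ 2) + d s' / (d s' ^ 2 + ω ^ 2)) := by
    intro ω
    rw [Finset.sum_mul_sum, Complex.re_sum]
    refine Finset.sum_congr rfl fun s _ => ?_
    rw [Complex.re_sum]
    refine Finset.sum_congr rfl fun s' _ => ?_
    rw [mul_mul_mul_comm, ← Complex.ofReal_mul, Complex.re_ofReal_mul,
      re_resolvent_mul_resolvent (hd s) (hd s')]
    ring
  have hint : ∀ s s', Integrable fun ω : ℝ => f s * g s' / (d s + d s') *
      (d s / (d s ^ 2 + ω ^ 2) + d s' / (d s' ^ 2 + ω ^ 2)) := fun s s' =>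
    ((integrable_poisson_kernel (hd s)).add (integrable_poisson_kernel (hd s'))).const_mul _
  simp only [h]
  rw [integral_finsetSum _ fun s _ => integrable_finsetSum _ fun s' _ => hint s s',
    Finset.mul_sum]
  refine Finset.sum_congr rfl fun s _ => ?_
  rw [integral_finsetSum _ fun s' _ => hint s s', Finset.mul_sum]
  refine Finset.sum_congr rfl fun s' _ => ?_
  rw [integral_const_mul, integral_add (integrable_poisson_kernel (hd s))
    (integrable_poisson_kernel (hd s')), integral_poisson_kernel (hd s),
    integral_poisson_kernel (hd s')]
  field_simp
  ring

/-- Quadratic growth of `α ^ 2 - 1` in `ω`. -/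
theorem le_alpha_sq_sub_one {lo hi α ω : ℝ} (h0 : 0 < lo) (hlt : lo < hi)
    (hα : α = (√(lo ^ 2 + ω ^ 2) + √(hi ^ 2 + ω ^ 2)) / (hi - lo)) :
    2 * (lo ^ 2 + ω ^ 2) / (hi - lo) ^ 2 ≤ α ^ 2 - 1 := by
  have hd : 0 < hi - lo := by linarith
  have h1 := Real.sq_sqrt (show 0 ≤ lo ^ 2 + ω ^ 2 by positivity)
  have h2 := Real.sq_sqrt (show 0 ≤ hi ^ 2 + ω ^ 2 by positivity)
  have h3 : √(lo ^ 2 + ω ^ 2) ≤ √(hi ^ 2 + ω ^ 2) := Real.sqrt_le_sqrt (by nlinarith)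
  have h4 := Real.sqrt_nonneg (lo ^ 2 + ω ^ 2)
  rw [hα, div_pow, div_sub_one (by positivity)]
  gcongr
  nlinarith

/-- Integrability of the function bounding the entries of the inverse. -/
theorem integrable_decay_bound {lo hi : ℝ} (h0 : 0 < lo) (hlt : lo < hi) {α R : ℝ → ℝ}
    (hα : ∀ ω : ℝ, α ω = (√(lo ^ 2 + ω ^ 2) + √(hi ^ 2 + ω ^ 2)) / (hi - lo))
    (hR : ∀ ω : ℝ, R ω = α ω + √(α ω ^ 2 - 1)) {p : ℝ} (hp : 0 ≤ p) :
    Integrable fun ω : ℝ => (R ω ^ 2 / (R ω ^ 2 - 1) ^ 2) ^ 2 * (1 / R ω) ^ (p - 2) := by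
  have hd : 0 < hi - lo := by linarith
  have hαm : Measurable α := by
    rw [funext hα]; fun_prop
  have hRm : Measurable R := by
    rw [funext hR]; fun_prop
  have hm : Measurable fun ω : ℝ =>
      (R ω ^ 2 / (R ω ^ 2 - 1) ^ 2) ^ 2 * (1 / R ω) ^ (p - 2) := by fun_prop
  set C : ℝ := (hi - lo) ^ 2 / (2 * lo ^ 2) with hC
  refine ((integrable_poisson_kernel h0).const_mul
    ((C + 1) * (hi - lo) ^ 2 / (8 * lo))).mono' hm.aestronglyMeasurable
    (Filter.Eventually.of_forall fun ω => ?_)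
  have hβ := le_alpha_sq_sub_one (ω := ω) h0 hlt (hα ω)
  have hα0 : 0 ≤ α ω := by rw [hα]; positivity
  have hRω := hR ω
  set a := α ω
  set r := R ω
  set β := √(a ^ 2 - 1) with hβd
  have hpos : 0 < 2 * (lo ^ 2 + ω ^ 2) / (hi - lo) ^ 2 := by positivity
  have hβ2 : β ^ 2 = a ^ 2 - 1 := Real.sq_sqrt (hpos.le.trans hβ)
  have hβ0 : 0 < β := Real.sqrt_pos.mpr (hpos.trans_le hβ)
  have ha1 : 1 < a := by nlinarith
  have hr1 : 1 < r := by linarith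
  have hr0 : 0 < r := by linarith
  have hfrac : r ^ 2 / (r ^ 2 - 1) ^ 2 = 1 / (4 * β ^ 2) := by
    have : r ^ 2 - 1 = 2 * β * r := by rw [hRω]; linear_combination -hβ2
    rw [this]
    field_simp
    norm_num
  have hpow : (1 / r) ^ (p - 2) ≤ r ^ 2 := by
    calc (1 / r) ^ (p - 2) ≤ (1 / r) ^ (-2 : ℝ) :=
          Real.rpow_le_rpow_of_exponent_ge (by positivity)
            ((div_le_one hr0).mpr hr1.le) (by linarith)
      _ = r ^ 2 := by
          rw [one_div, Real.inv_rpow hr0.le, Real.rpow_neg hr0.le, inv_inv]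
          exact_mod_cast Real.rpow_natCast r 2
  have hr2 : r ^ 2 ≤ 4 * a ^ 2 := by
    have : β ≤ a := by nlinarith
    nlinarith
  have hCβ : 1 ≤ C * β ^ 2 := by
    rw [hβ2]
    calc (1 : ℝ) ≤ C * (2 * (lo ^ 2 + ω ^ 2) / (hi - lo) ^ 2) := by
          rw [hC, div_mul_div_comm, le_div_iff₀ (by positivity)]
          nlinarith [mul_nonneg (sq_nonneg (hi - lo)) (sq_nonneg ω)]
      _ ≤ _ := by gcongr
  have ha2 : a ^ 2 ≤ (C + 1) * β ^ 2 := by linarith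
  have hC0 : 0 < C := by positivity
  rw [Real.norm_of_nonneg (by positivity), hfrac]
  calc (1 / (4 * β ^ 2)) ^ 2 * (1 / r) ^ (p - 2)
      ≤ (1 / (4 * β ^ 2)) ^ 2 * (4 * ((C + 1) * β ^ 2)) := by
        gcongr
        linarith
    _ = (C + 1) / 4 * (1 / β ^ 2) := by field_simp
    _ ≤ (C + 1) / 4 * (1 / (2 * (lo ^ 2 + ω ^ 2) / (hi - lo) ^ 2)) := by
        rw [← hβ2] at hβ
        gcongr
    _ = _ := by field_simp; norm_num

/-- Spectral decomposition of a real symmetric matrix, with transposes. -/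
theorem eigenvectorUnitary_decomposition {n : ℕ} {M : Matrix (Fin n) (Fin n) ℝ}
    (hM : M.IsHermitian) : ∃ U : Matrix (Fin n) (Fin n) ℝ, Uᵀ * U = 1 ∧ U * Uᵀ = 1 ∧
      M = U * diagonal hM.eigenvalues * Uᵀ := by
  have hs : star (hM.eigenvectorUnitary : Matrix (Fin n) (Fin n) ℝ) =
      (hM.eigenvectorUnitary : Matrix (Fin n) (Fin n) ℝ)ᵀ := by
    rw [star_eq_conjTranspose, conjTranspose_eq_transpose_of_trivial]
  refine ⟨hM.eigenvectorUnitary, ?_, ?_, ?_⟩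
  · rw [← hs]; exact Unitary.coe_star_mul_self _
  · rw [← hs]; exact Unitary.coe_mul_star_self _
  · rw [← hs]
    exact hM.spectral_theorem

/-- The largest `k` with `b * k < d` satisfies `d / b - 1 ≤ k`. -/
theorem div_sub_one_le_natCast_div {d b : ℕ} (hb : 0 < b) :
    (d : ℝ) / b - 1 ≤ ((d - 1) / b : ℕ) := by
  have hb' : (0 : ℝ) < b := by exact_mod_cast hb
  have h : d ≤ b * ((d - 1) / b + 1) := by
    have := Nat.lt_mul_div_succ (d - 1) hb
    omega
  rw [sub_le_iff_le_add, div_le_iff₀ hb', mul_comm]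
  exact_mod_cast h

/-- Off-diagonal decay of the resolvent of a banded symmetric matrix on a vertical line. -/
theorem norm_resolvent_entry_le {n b : ℕ} (hb : 0 < b) {M U : Matrix (Fin n) (Fin n) ℝ}
    {d : Fin n → ℝ} (hU : Uᵀ * U = 1) (hU' : U * Uᵀ = 1) (hMU : M = U * diagonal d * Uᵀ)
    (hband : ∀ a c : Fin n, (b : ℤ) < |(a : ℤ) - (c : ℤ)| → M a c = 0)
    {lo hi : ℝ} (h0 : 0 < lo) (hlt : lo < hi) (hd : ∀ s, d s ∈ Set.Icc lo hi) (ω : ℝ)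
    {α R : ℝ} (hα : α = (√(lo ^ 2 + ω ^ 2) + √(hi ^ 2 + ω ^ 2)) / (hi - lo))
    (hR : R = α + √(α ^ 2 - 1)) {a c : Fin n} (hac : a ≠ c) :
    ‖∑ s, (U a s * U c s : ℝ) * ((d s : ℂ) + ω * Complex.I)⁻¹‖ ≤
      8 / (hi - lo) * (R ^ 2 / (R ^ 2 - 1) ^ 2) * (1 / R) ^ (|(a : ℝ) - c| / b - 1) := by
  set D := ((a : ℤ) - (c : ℤ)).natAbs with hD
  have hD0 : D ≠ 0 := by
    have := Fin.val_ne_of_ne hac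
    omega
  have hDabs : ((D : ℤ)) = |(a : ℤ) - (c : ℤ)| := Int.natCast_natAbs _
  have hDr : (D : ℝ) = |(a : ℝ) - c| := by
    have := congrArg (fun x : ℤ => (x : ℝ)) hDabs
    simpa using this
  obtain ⟨p, hpd, hp⟩ := exists_polynomial_approx_resolvent h0 hlt ω hα hR ((D - 1) / b)
  have hlt' : (b : ℤ) * p.natDegree < |(a : ℤ) - (c : ℤ)| := by
    rw [← hDabs]
    have h1 : b * p.natDegree ≤ b * ((D - 1) / b) := Nat.mul_le_mul_left _ hpd
    have h2 := Nat.mul_div_le (D - 1) b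
    have : b * p.natDegree < D := by omega
    exact_mod_cast this
  have h := norm_sum_spectral_le hU hU' hMU hband
    (fun s => ((d s : ℂ) + ω * Complex.I)⁻¹) p (fun s => hp (d s) (hd s)) a c hlt'
  simp only [Complex.ofReal_mul]
  refine h.trans ?_
  have hβ := le_alpha_sq_sub_one (ω := ω) h0 hlt hα
  have hdd : 0 < hi - lo := by linarith
  have hα0 : 0 ≤ α := by rw [hα]; positivity
  have hα1 : 1 ≤ α := by
    have : 0 ≤ 2 * (lo ^ 2 + ω ^ 2) / (hi - lo) ^ 2 := by positivity
    nlinarith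
  have hR1 : 1 ≤ R := by
    have := Real.sqrt_nonneg (α ^ 2 - 1)
    linarith
  have hR0 : 0 < R := by linarith
  refine mul_le_mul_of_nonneg_left ?_ (by positivity)
  rw [← Real.rpow_natCast, ← hDr]
  exact Real.rpow_le_rpow_of_exponent_ge (by positivity) ((div_le_one hR0).mpr hR1)
    (div_sub_one_le_natCast_div hb)

/-- Proposition 4.1 (i): integral bound for the entries of `S⁻¹` for `b`-banded
SPD `M`, when both grid coordinates differ. -/
theorem kronSum_inv_entry_integral_bound_offdiag_banded
    (n b : ℕ) (hb : 0 < b)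
    (M : Matrix (Fin n) (Fin n) ℝ) (hM : M.PosDef)
    (hband : ∀ a c : Fin n, (b : ℤ) < |(a : ℤ) - (c : ℤ)| → M a c = 0)
    (lammin lammax : ℝ)
    (hmin : IsLeast (Set.range hM.1.eigenvalues) lammin)
    (hmax : IsGreatest (Set.range hM.1.eigenvalues) lammax)
    (hlt : lammin < lammax)
    (k t : ℕ) (hk1 : 1 ≤ k) (hk2 : k ≤ n * n) (ht1 : 1 ≤ t) (ht2 : t ≤ n * n)
    (i j ℓ m : ℕ)
    (hj : j = (t - 1) / n + 1) (hi : i = t - n * ((t - 1) / n))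
    (hm : m = (k - 1) / n + 1) (hl : ℓ = k - n * ((k - 1) / n))
    (hne1 : i ≠ ℓ) (hne2 : j ≠ m)
    (α R : ℝ → ℝ)
    (hα : ∀ ω : ℝ, α ω =
      (Real.sqrt (lammin ^ 2 + ω ^ 2) + Real.sqrt (lammax ^ 2 + ω ^ 2)) / (lammax - lammin))
    (hR : ∀ ω : ℝ, R ω = α ω + Real.sqrt (α ω ^ 2 - 1)) :
    |(kronSum n M)⁻¹ ⟨k - 1, by omega⟩ ⟨t - 1, by omega⟩| ≤
      (1 / (2 * Real.pi)) * (64 / (lammax - lammin) ^ 2) *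
        ∫ ω : ℝ, (R ω ^ 2 / (R ω ^ 2 - 1) ^ 2) ^ 2 *
          (1 / R ω) ^ (|(i : ℝ) - (ℓ : ℝ)| / b + |(j : ℝ) - (m : ℝ)| / b - 2) := by
  obtain ⟨U, hU, hU', hMU⟩ := eigenvectorUnitary_decomposition hM.1
  set d := hM.1.eigenvalues
  have hdpos : ∀ s, 0 < d s := hM.eigenvalues_pos
  have hmem : ∀ s, d s ∈ Set.Icc lammin lammax := fun s =>
    ⟨hmin.2 (Set.mem_range_self s), hmax.2 (Set.mem_range_self s)⟩
  have h0 : 0 < lammin := by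
    obtain ⟨s, hs⟩ := hmin.1
    exact hs ▸ hdpos s
  set κ : Fin (n * n) := ⟨k - 1, by omega⟩ with hκ
  set τ : Fin (n * n) := ⟨t - 1, by omega⟩ with hτ
  have hj' : j = (τ.divNat : ℕ) + 1 := by rw [hj, Fin.coe_divNat]
  have hm' : m = (κ.divNat : ℕ) + 1 := by rw [hm, Fin.coe_divNat]
  have hi' : i = (τ.modNat : ℕ) + 1 := by
    have := Nat.div_add_mod (t - 1) n
    rw [hi, Fin.coe_modNat]
    simp only [hτ]
    omega
  have hl' : ℓ = (κ.modNat : ℕ) + 1 := by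
    have := Nat.div_add_mod (k - 1) n
    rw [hl, Fin.coe_modNat]
    simp only [hκ]
    omega
  have hne1' : κ.modNat ≠ τ.modNat := fun h => hne1 (by rw [hi', hl', h])
  have hne2' : κ.divNat ≠ τ.divNat := fun h => hne2 (by rw [hj', hm', h])
  have hil : |((κ.modNat : ℕ) : ℝ) - (τ.modNat : ℕ)| = |(i : ℝ) - ℓ| := by
    rw [hi', hl', abs_sub_comm]; push_cast; ring_nf
  have hjm : |((κ.divNat : ℕ) : ℝ) - (τ.divNat : ℕ)| = |(j : ℝ) - m| := by
    rw [hj', hm', abs_sub_comm]; push_cast; ring_nf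
  rw [kronSum_inv_apply hU hU' hMU hdpos, sum_sum_div_eq_integral hdpos
    (fun s => U κ.modNat s * U τ.modNat s) (fun s => U κ.divNat s * U τ.divNat s),
    abs_mul, abs_of_pos (by positivity : 0 < 1 / (2 * π)), mul_assoc]
  refine mul_le_mul_of_nonneg_left ?_ (by positivity)
  rw [← integral_const_mul, ← Real.norm_eq_abs]
  refine norm_integral_le_of_norm_le ((integrable_decay_bound h0 hlt hα hR
    (by positivity)).const_mul _) (Filter.Eventually.of_forall fun ω => ?_)
  have hR0 : 0 < R ω := by
    have : 0 < α ω := by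
      have : 0 < lammax - lammin := by linarith
      have : 0 < √(lammin ^ 2 + ω ^ 2) := by positivity
      rw [hα]; positivity
    rw [hR]; positivity
  have h1 := norm_resolvent_entry_le hb hU hU' hMU hband h0 hlt hmem ω (hα ω) (hR ω) hne1'
  have h2 := norm_resolvent_entry_le hb hU hU' hMU hband h0 hlt hmem (-ω)
    (by rw [neg_sq]; exact hα ω) (hR ω) hne2'
  rw [hil] at h1
  rw [hjm] at h2
  rw [Real.norm_eq_abs]
  refine (Complex.abs_re_le_norm _).trans ?_
  rw [norm_mul]
  refine (mul_le_mul h1 h2 (norm_nonneg _) ((norm_nonneg _).trans h1)).trans (le_of_eq ?_)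
  rw [show |(i : ℝ) - ℓ| / b + |(j : ℝ) - m| / b - 2 =
    (|(i : ℝ) - ℓ| / b - 1) + (|(j : ℝ) - m| / b - 1) by ring,
    Real.rpow_add (by positivity : 0 < 1 / R ω)]
  generalize lammax - lammin = Δ
  ring
end
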